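/- Let Σ be a topological Markov shift and let r: Σ → (0,∞) be Hölder continuous and bounded away from zero and infinity. Then there exist constants C₁ > 0 and κ ∈ (0,1), depending only on r, such that for all z = (x,t) and w = (y,s) in Σ_r: d_r(z,w) ≤ C₁·[d(x,y)^κ + |t − s|]. -/

import Mathlib

/-- The topological Markov shift: bi-infinite paths of the directed graph with
vertex set `V` and edge relation `E`. -/
abbrev TMS (V : Type) (E : V → V → Prop) : Type :=
  {x : ℤ → V // ∀ i : ℤ, E (x i) (x (i + 1))}

/-- The `n`-th power of the left shift map (`n ∈ ℤ`); `shiftZ 1` is the left shift `σ`. -/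
def shiftZ {V : Type} {E : V → V → Prop} (n : ℤ) (x : TMS V E) : TMS V E :=
  ⟨fun i => x.1 (i + n), fun i => by
    have h := x.2 (i + n)
    have e : i + n + 1 = i + 1 + n := by ring
    rw [e] at h
    exact h⟩

open Classical in
/-- The metric `d(u,v) = exp (-min {|n| : uₙ ≠ vₙ})` on the topological Markov shift. -/
noncomputable def tmsDist {V : Type} {E : V → V → Prop} (x y : TMS V E) : ℝ :=
  if x = y then 0
  else Real.exp (-((sInf {k : ℕ | ∃ n : ℤ, n.natAbs = k ∧ x.1 n ≠ y.1 n} : ℕ) : ℝ))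

/-- The unit suspension space `Σ_1 = {(x,t) : x ∈ Σ, 0 ≤ t < 1}`. -/
def Sigma1 (V : Type) (E : V → V → Prop) : Type :=
  {p : TMS V E × ℝ // 0 ≤ p.2 ∧ p.2 < 1}

/-- The suspension flow `ψ^τ (x,t) = (σ^n x, t + τ - n)` for the unique `n ∈ ℤ` with
`0 ≤ t + τ - n < 1`, namely `n = ⌊t + τ⌋`. -/
noncomputable def susp {V : Type} {E : V → V → Prop} (τ : ℝ) (z : Sigma1 V E) :
    Sigma1 V E :=
  ⟨(shiftZ ⌊z.1.2 + τ⌋ z.1.1, Int.fract (z.1.2 + τ)),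
    Int.fract_nonneg _, Int.fract_lt_one _⟩

/-- Length of the horizontal segment `[z,w]_h` (for `z, w` of the same height `t`):
`(1-t)·d(x,y) + t·d(σx, σy)`. -/
noncomputable def hlen {V : Type} {E : V → V → Prop} (z w : Sigma1 V E) : ℝ :=
  (1 - z.1.2) * tmsDist z.1.1 w.1.1 + z.1.2 * tmsDist (shiftZ 1 z.1.1) (shiftZ 1 w.1.1)

/-- Length of the vertical segment `[z,w]_v`: `inf {|t| : w = ψ^t z}`. -/
noncomputable def vlen {V : Type} {E : V → V → Prop} (z w : Sigma1 V E) : ℝ :=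
  sInf {c : ℝ | ∃ t : ℝ, susp t z = w ∧ c = |t|}

/-- Admissible costs of a single step of a basic path from `z` to `w`: either `z, w`
form a horizontal segment (same height) of length `hlen z w`, or a vertical segment
(`w = ψ^t z` for some `t`) of length `vlen z w`. -/
def stepCost {V : Type} {E : V → V → Prop} (z w : Sigma1 V E) : Set ℝ :=
  {c | (z.1.2 = w.1.2 ∧ c = hlen z w) ∨ ((∃ t : ℝ, susp t z = w) ∧ c = vlen z w)}

/-- The set of lengths of basic paths from `z` to `w`. -/
def pathCosts {V : Type} {E : V → V → Prop} (z w : Sigma1 V E) : Set ℝ :=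
  {c | ∃ (n : ℕ) (zs : ℕ → Sigma1 V E) (cs : ℕ → ℝ),
    zs 0 = z ∧ zs n = w ∧ (∀ i < n, cs i ∈ stepCost (zs i) (zs (i + 1))) ∧
    c = ∑ i ∈ Finset.range n, cs i}

/-- The Bowen–Walters metric on `Σ_1`: infimum of lengths of basic paths. -/
noncomputable def d1 {V : Type} {E : V → V → Prop} (z w : Sigma1 V E) : ℝ :=
  sInf (pathCosts z w)

/-- The phase space `Σ_r = {(x,t) : x ∈ Σ, 0 ≤ t < r(x)}` of the topological Markov flow. -/
def SigmaR (V : Type) (E : V → V → Prop) (r : TMS V E → ℝ) : Type :=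
  {p : TMS V E × ℝ // 0 ≤ p.2 ∧ p.2 < r p.1}

open Classical in
/-- The canonical bijection `ϑ_r : Σ_r → Σ_1`, `ϑ_r(x,t) = (x, t/r(x))`
(junk value if `r(x) ≤ 0`). -/
noncomputable def thetaR {V : Type} {E : V → V → Prop} (r : TMS V E → ℝ)
    (z : SigmaR V E r) : Sigma1 V E :=
  if h : 0 < r z.1.1 then
    ⟨(z.1.1, z.1.2 / r z.1.1), div_nonneg z.2.1 h.le, (div_lt_one h).2 z.2.2⟩
  else ⟨(z.1.1, 0), le_refl 0, zero_lt_one⟩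

/-- The Bowen–Walters distance on `Σ_r`: `d_r(z,w) = d_1(ϑ_r z, ϑ_r w)`. -/
noncomputable def dr {V : Type} {E : V → V → Prop} (r : TMS V E → ℝ)
    (z w : SigmaR V E r) : ℝ :=
  d1 (thetaR r z) (thetaR r w)

lemma tmsDist_nonneg {V : Type} {E : V → V → Prop} (x y : TMS V E) : 0 ≤ tmsDist x y := by
  unfold tmsDist
  split_ifs
  · exact le_rfl
  · exact (Real.exp_pos _).le

lemma tmsDist_le_one {V : Type} {E : V → V → Prop} (x y : TMS V E) : tmsDist x y ≤ 1 := by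
  unfold tmsDist
  split_ifs
  · exact zero_le_one
  · exact Real.exp_le_one_iff.2 (neg_nonpos.2 (Nat.cast_nonneg _))

/-- The left shift expands distances by a factor of at most `e`. -/
lemma tmsDist_shiftZ_one_le {V : Type} {E : V → V → Prop} (x y : TMS V E) :
    tmsDist (shiftZ 1 x) (shiftZ 1 y) ≤ Real.exp 1 * tmsDist x y := by
  by_cases hxy : x = y
  · simp [hxy, tmsDist]
  by_cases hs : shiftZ 1 x = shiftZ 1 y
  · rw [tmsDist, if_pos hs]
    exact mul_nonneg (Real.exp_pos 1).le (tmsDist_nonneg x y)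
  rw [tmsDist, tmsDist, if_neg hs, if_neg hxy, ← Real.exp_add, Real.exp_le_exp]
  have hne : {k : ℕ | ∃ n : ℤ, n.natAbs = k ∧
      (shiftZ 1 x).1 n ≠ (shiftZ 1 y).1 n}.Nonempty := by
    by_contra h
    refine hs (Subtype.ext (funext fun n => ?_))
    by_contra hn
    exact h ⟨n.natAbs, n, rfl, hn⟩
  obtain ⟨n, hn, hd⟩ := Nat.sInf_mem hne
  have hle : sInf {k : ℕ | ∃ n : ℤ, n.natAbs = k ∧ x.1 n ≠ y.1 n} ≤ (n + 1).natAbs :=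
    Nat.sInf_le ⟨n + 1, rfl, hd⟩
  have hle' := hle.trans (Int.natAbs_add_le n 1)
  rw [hn] at hle'
  have hcast := Nat.cast_le (α := ℝ).2 hle'
  push_cast at hcast
  linarith

lemma hlen_nonneg {V : Type} {E : V → V → Prop} (z w : Sigma1 V E) : 0 ≤ hlen z w :=
  add_nonneg (mul_nonneg (sub_nonneg.2 z.2.2.le) (tmsDist_nonneg _ _))
    (mul_nonneg z.2.1 (tmsDist_nonneg _ _))

lemma hlen_le {V : Type} {E : V → V → Prop} (z w : Sigma1 V E) :
    hlen z w ≤ Real.exp 1 * tmsDist z.1.1 w.1.1 := by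
  have h0 := tmsDist_nonneg z.1.1 w.1.1
  have h1 : tmsDist z.1.1 w.1.1 ≤ Real.exp 1 * tmsDist z.1.1 w.1.1 :=
    le_mul_of_one_le_left h0 (Real.one_le_exp zero_le_one)
  have h2 := mul_le_mul_of_nonneg_left h1 (sub_nonneg.2 z.2.2.le)
  have h3 := mul_le_mul_of_nonneg_left (tmsDist_shiftZ_one_le z.1.1 w.1.1) z.2.1
  unfold hlen
  linarith

lemma vlen_nonneg {V : Type} {E : V → V → Prop} (z w : Sigma1 V E) : 0 ≤ vlen z w := by
  refine Real.sInf_nonneg ?_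
  rintro c ⟨t, -, rfl⟩
  exact abs_nonneg t

lemma vlen_le {V : Type} {E : V → V → Prop} {z w : Sigma1 V E} {t : ℝ} (h : susp t z = w) :
    vlen z w ≤ |t| := by
  refine csInf_le ⟨0, ?_⟩ ⟨t, h, rfl⟩
  rintro c ⟨t, -, rfl⟩
  exact abs_nonneg t

lemma stepCost_nonneg {V : Type} {E : V → V → Prop} {z w : Sigma1 V E} {c : ℝ}
    (h : c ∈ stepCost z w) : 0 ≤ c := by
  rcases h with ⟨-, rfl⟩ | ⟨-, rfl⟩
  · exact hlen_nonneg z w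
  · exact vlen_nonneg z w

lemma bddBelow_pathCosts {V : Type} {E : V → V → Prop} (z w : Sigma1 V E) :
    BddBelow (pathCosts z w) := by
  refine ⟨0, ?_⟩
  rintro c ⟨n, zs, cs, -, -, hcs, rfl⟩
  exact Finset.sum_nonneg fun i hi => stepCost_nonneg (hcs i (Finset.mem_range.1 hi))

/-- Two consecutive segments bound the Bowen–Walters metric. -/
lemma d1_le_add {V : Type} {E : V → V → Prop} {z u w : Sigma1 V E} {c c' : ℝ}
    (h : c ∈ stepCost z u) (h' : c' ∈ stepCost u w) : d1 z w ≤ c + c' := by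
  refine csInf_le (bddBelow_pathCosts z w)
    ⟨2, fun i => if i = 0 then z else if i = 1 then u else w,
      fun i => if i = 0 then c else c', by simp, by simp, ?_, by simp [Finset.sum_range_succ]⟩
  intro i hi
  interval_cases i
  · simpa using h
  · simpa using h'

lemma susp_sub {V : Type} {E : V → V → Prop} (z w : Sigma1 V E) :
    susp (w.1.2 - z.1.2) z = ⟨(z.1.1, w.1.2), w.2⟩ := by
  have h : z.1.2 + (w.1.2 - z.1.2) = w.1.2 := by ring
  have hf : ⌊w.1.2⌋ = 0 := Int.floor_eq_zero_iff.2 w.2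
  refine Subtype.ext (Prod.ext (Subtype.ext ?_) ?_)
  · funext i
    simp [susp, shiftZ, hf]
  · simp only [susp, h]
    exact Int.fract_eq_self.2 w.2

lemma d1_le {V : Type} {E : V → V → Prop} (z w : Sigma1 V E) :
    d1 z w ≤ |z.1.2 - w.1.2| + Real.exp 1 * tmsDist z.1.1 w.1.1 := by
  let u : Sigma1 V E := ⟨(z.1.1, w.1.2), w.2⟩
  have hzu : susp (w.1.2 - z.1.2) z = u := susp_sub z w
  have hv : vlen z u ≤ |z.1.2 - w.1.2| := (vlen_le hzu).trans_eq (abs_sub_comm _ _)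
  exact (d1_le_add (Or.inr ⟨⟨_, hzu⟩, rfl⟩) (Or.inl ⟨rfl, rfl⟩) :
    d1 z w ≤ vlen z u + hlen u w).trans
    (add_le_add hv (hlen_le u w))

lemma thetaR_val {V : Type} {E : V → V → Prop} {r : TMS V E → ℝ} {z : SigmaR V E r}
    (h : 0 < r z.1.1) : (thetaR r z).1 = (z.1.1, z.1.2 / r z.1.1) := by
  exact congrArg Subtype.val (dif_pos h)

lemma abs_div_sub_div_le {a b p q s t : ℝ} (ha : 0 < a) (hp : a ≤ p) (hq : a ≤ q)
    (hs : |s| ≤ b) :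
    |t / p - s / q| ≤ |t - s| / a + b / a ^ 2 * |p - q| := by
  have hp0 := ha.trans_le hp
  have hq0 := ha.trans_le hq
  have e : t / p - s / q = (t - s) / p + s / (p * q) * (q - p) := by
    field_simp
    ring
  rw [e]
  refine (abs_add_le _ _).trans (add_le_add ?_ ?_)
  · rw [abs_div, abs_of_pos hp0]
    gcongr
  · rw [abs_mul, abs_div, abs_of_pos (mul_pos hp0 hq0), abs_sub_comm q p, pow_two]
    have : 0 ≤ b := (abs_nonneg s).trans hs
    gcongr

/-- upper bound for the Bowen–Walters distance:
`d_r((x,t),(y,s)) ≤ C₁ [d(x,y)^κ + |t - s|]`. -/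
theorem stmt15 (V : Type) (E : V → V → Prop)
    (hin : ∀ v, ∃ u, E u v) (hout : ∀ v, ∃ w, E v w)
    (r : TMS V E → ℝ) (a b H α : ℝ) (ha : 0 < a) (hab : ∀ x, a ≤ r x ∧ r x ≤ b)
    (hH : 0 < H) (hα : 0 < α) (hα1 : α ≤ 1)
    (hHol : ∀ x y : TMS V E, |r x - r y| ≤ H * tmsDist x y ^ α) :
    ∃ C₁ κ : ℝ, 0 < C₁ ∧ 0 < κ ∧ κ < 1 ∧
      ∀ z w : SigmaR V E r,
        dr r z w ≤ C₁ * (tmsDist z.1.1 w.1.1 ^ κ + |z.1.2 - w.1.2|) := by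
  refine ⟨1 / a + |b| / a ^ 2 * H + Real.exp 1, α / 2, by positivity, by linarith, by linarith, ?_⟩
  intro z w
  have hz := ha.trans_le (hab z.1.1).1
  have hw := ha.trans_le (hab w.1.1).1
  have key := d1_le (thetaR r z) (thetaR r w)
  have hs : |w.1.2| ≤ |b| := by
    rw [abs_of_nonneg w.2.1]
    exact (w.2.2.le.trans (hab w.1.1).2).trans (le_abs_self b)
  have habs := abs_div_sub_div_le (t := z.1.2) ha (hab z.1.1).1 (hab w.1.1).1 hs
  rw [thetaR_val hz, thetaR_val hw] at key
  have hd0 := tmsDist_nonneg z.1.1 w.1.1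
  have hd1 := tmsDist_le_one z.1.1 w.1.1
  have hr := hHol z.1.1 w.1.1
  set D := tmsDist z.1.1 w.1.1
  have hα' : D ^ α ≤ D ^ (α / 2) :=
    Real.rpow_le_rpow_of_exponent_ge_of_imp hd0 hd1 (by linarith) fun _ h => by linarith
  have hD : D ≤ D ^ (α / 2) := by
    simpa using Real.rpow_le_rpow_of_exponent_ge_of_imp (y := 1) (z := α / 2) hd0 hd1
      (by linarith) fun _ h => by linarith
  have hP : 0 ≤ D ^ (α / 2) := Real.rpow_nonneg hd0 _
  have hHolder : |b| / a ^ 2 * |r z.1.1 - r w.1.1| ≤ |b| / a ^ 2 * H * D ^ (α / 2) := by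
    rw [mul_assoc]
    gcongr
    exact hr.trans (by gcongr)
  have hexp : Real.exp 1 * D ≤ Real.exp 1 * D ^ (α / 2) := by gcongr
  have hT := abs_nonneg (z.1.2 - w.1.2)
  have c1 : 0 ≤ 1 / a * D ^ (α / 2) := by positivity
  have c2 : 0 ≤ (|b| / a ^ 2 * H + Real.exp 1) * |z.1.2 - w.1.2| := by positivity
  have hdiv : |z.1.2 - w.1.2| / a = 1 / a * |z.1.2 - w.1.2| := by ring
  calc dr r z w ≤ _ := key
    _ ≤ 1 / a * |z.1.2 - w.1.2| + |b| / a ^ 2 * H * D ^ (α / 2)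
        + Real.exp 1 * D ^ (α / 2) := by linarith
    _ ≤ _ := by linarith
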